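/- Let M be an invertible n×n integer matrix with rows M_1,…,M_n, set M_{n+1} = −(M_1 + ⋯ + M_n), let M̃ be the (n+1)×n integer matrix with rows M_1,…,M_{n+1}, and let α ∈ ℂⁿ, α_{n+1} ∈ ℂ, α̃ = (α_1,…,α_n,α_{n+1}), |α̃| = α_1 + ⋯ + α_n + α_{n+1}. For v ∈ ℂⁿ write x^v = ∏_{i=1}^n x_i^{v_i} (principal branches). Then on the open set U = {x ∈ (ℂ∖(−∞,0])ⁿ : 1 + Σ_{j=1}^n x^{−M^{−1}e_j} ∉ (−∞,0]} the function f(x) = x^{−M^{−1}α} · (1 + Σ_{j=1}^n x^{−M^{−1}e_j})^{−|α̃|} satisfies every equation of the simplicial Horn system Horn(M̃, α̃), where e_j ∈ ℝⁿ is the j-th standard basis vector. (Solution formula for simplicial hypergeometric configurations.) -/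

import Mathlib

open scoped BigOperators

/-- The operator `θ_k = x_k ∂/∂x_k` acting on functions of `n` complex variables. -/
noncomputable def th {n : ℕ} (k : Fin n) (f : (Fin n → ℂ) → ℂ) : (Fin n → ℂ) → ℂ :=
  fun x => x k * fderiv ℂ f x (Pi.single k 1)

/-- The first-order operator `⟨a, θ⟩ + c`. -/
noncomputable def linFactor {n : ℕ} (a : Fin n → ℤ) (c : ℂ) (f : (Fin n → ℂ) → ℂ) :
    (Fin n → ℂ) → ℂ :=
  fun x => (∑ k, (a k : ℂ) * th k f x) + c * f x

/-- The operator `∏_{ℓ=0}^{N-1} (⟨a, θ⟩ + c + ℓ)` (the factors commute). -/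
noncomputable def factorPow {n : ℕ} (a : Fin n → ℤ) (c : ℂ) :
    ℕ → ((Fin n → ℂ) → ℂ) → ((Fin n → ℂ) → ℂ)
  | 0 => id
  | N + 1 => fun f => linFactor a (c + N) (factorPow a c N f)

/-- The operator `P_k(θ)` of the Horn system `Horn(A, c)`. -/
noncomputable def Pop {m n : ℕ} (A : Fin m → Fin n → ℤ) (c : Fin m → ℂ) (k : Fin n)
    (f : (Fin n → ℂ) → ℂ) : (Fin n → ℂ) → ℂ :=
  (List.finRange m).foldr
    (fun i g => if 0 < A i k then factorPow (A i) (c i) (A i k).toNat g else g) f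

/-- The operator `Q_k(θ)` of the Horn system `Horn(A, c)`. -/
noncomputable def Qop {m n : ℕ} (A : Fin m → Fin n → ℤ) (c : Fin m → ℂ) (k : Fin n)
    (f : (Fin n → ℂ) → ℂ) : (Fin n → ℂ) → ℂ :=
  (List.finRange m).foldr
    (fun i g => if A i k < 0 then factorPow (A i) (c i) (A i k).natAbs g else g) f

/-- `f` satisfies every equation `x_k P_k(θ) f = Q_k(θ) f` of `Horn(A, c)` on `U`. -/
def HornSol {m n : ℕ} (A : Fin m → Fin n → ℤ) (c : Fin m → ℂ) (U : Set (Fin n → ℂ))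
    (f : (Fin n → ℂ) → ℂ) : Prop :=
  ∀ k : Fin n, ∀ x ∈ U, x k * Pop A c k f x = Qop A c k f x


/-- The inverse of an integer matrix, viewed as a complex matrix. -/
noncomputable def Minv {n : ℕ} (M : Matrix (Fin n) (Fin n) ℤ) : Matrix (Fin n) (Fin n) ℂ :=
  (M.map (Int.cast : ℤ → ℂ))⁻¹

/-- `x^v = ∏ i, x_i^{v_i}` with principal branches. -/
noncomputable def xpow {n : ℕ} (x : Fin n → ℂ) (v : Fin n → ℂ) : ℂ := ∏ i, x i ^ v i

section

open Filter Topology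

theorem linFactor_eq_fderiv {n : ℕ} (b : Fin n → ℤ) (c : ℂ) (f : (Fin n → ℂ) → ℂ)
    (x : Fin n → ℂ) :
    linFactor b c f x = fderiv ℂ f x (fun k => (b k : ℂ) * x k) + c * f x := by
  have h : (fun k => (b k : ℂ) * x k)
      = ∑ k, ((b k : ℂ) * x k) • (Pi.single k (1 : ℂ) : Fin n → ℂ) := by
    ext j
    simp [Finset.sum_apply, Pi.single_apply]
  rw [h, map_sum]
  simp [linFactor, th, mul_assoc]

theorem linFactor_eqOn {n : ℕ} (b : Fin n → ℤ) (c : ℂ) {f g : (Fin n → ℂ) → ℂ}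
    {U : Set (Fin n → ℂ)} (hU : IsOpen U) (h : Set.EqOn f g U) :
    Set.EqOn (linFactor b c f) (linFactor b c g) U := by
  intro x hx
  rw [linFactor_eq_fderiv, linFactor_eq_fderiv, h hx,
    (h.eventuallyEq_of_mem (hU.mem_nhds hx)).fderiv_eq]

/-- If `⟨A_i, θ⟩ + c_i + w_i` maps `G w` to `G (w + e_i)`, then `∏_{ℓ<N} (⟨A_i, θ⟩ + c_i + ℓ)`
replaces a vanishing `i`-th index by `N`. -/
theorem factorPow_eqOn_update {m n : ℕ} {A : Fin m → Fin n → ℤ} {c : Fin m → ℂ}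
    {U : Set (Fin n → ℂ)} (hU : IsOpen U) {G : (Fin m → ℕ) → (Fin n → ℂ) → ℂ}
    (hG : ∀ i w, Set.EqOn (linFactor (A i) (c i + (w i : ℕ)) (G w))
      (G (Function.update w i (w i + 1))) U)
    {f : (Fin n → ℂ) → ℂ} {w : Fin m → ℕ} (hf : Set.EqOn f (G w) U) {i : Fin m}
    (hw : w i = 0) (N : ℕ) :
    Set.EqOn (factorPow (A i) (c i) N f) (G (Function.update w i N)) U := by
  induction N with
  | zero => rwa [← hw, Function.update_eq_self, hw]
  | succ N ih =>
    have h := hG i (Function.update w i N)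
    simp only [Function.update_self, Function.update_idem] at h
    exact (linFactor_eqOn (A i) (c i + N) hU ih).trans h

theorem foldr_factorPow_eqOn {m n : ℕ} {A : Fin m → Fin n → ℤ} {c : Fin m → ℂ}
    {U : Set (Fin n → ℂ)} (hU : IsOpen U) {G : (Fin m → ℕ) → (Fin n → ℂ) → ℂ}
    (hG : ∀ i w, Set.EqOn (linFactor (A i) (c i + (w i : ℕ)) (G w))
      (G (Function.update w i (w i + 1))) U)
    (p : Fin m → Prop) [DecidablePred p] (N : Fin m → ℕ) {l : List (Fin m)} (hl : l.Nodup) :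
    Set.EqOn (l.foldr (fun i g => if p i then factorPow (A i) (c i) (N i) g else g) (G 0))
      (G (fun j => if j ∈ l ∧ p j then N j else 0)) U := by
  induction l with
  | nil =>
    intro x _
    simp [Pi.zero_def]
  | cons i l ih =>
    obtain ⟨hi, hl⟩ := List.nodup_cons.1 hl
    rw [List.foldr_cons]
    by_cases hp : p i
    · rw [if_pos hp]
      convert factorPow_eqOn_update hU hG (ih hl) (i := i) (by simp [hi]) (N i) using 2
      ext j
      by_cases hj : j = i
      · subst hj
        simp [hp]
      · simp [hj]
    · rw [if_neg hp]
      convert ih hl using 2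
      ext j
      by_cases hj : j = i
      · subst hj
        simp [hp]
      · simp [hj]

theorem Pop_eqOn {m n : ℕ} {A : Fin m → Fin n → ℤ} {c : Fin m → ℂ}
    {U : Set (Fin n → ℂ)} (hU : IsOpen U) {G : (Fin m → ℕ) → (Fin n → ℂ) → ℂ}
    (hG : ∀ i w, Set.EqOn (linFactor (A i) (c i + (w i : ℕ)) (G w))
      (G (Function.update w i (w i + 1))) U) (k : Fin n) :
    Set.EqOn (Pop A c k (G 0)) (G (fun j => (A j k).toNat)) U := by
  convert foldr_factorPow_eqOn hU hG (fun i => 0 < A i k) (fun i => (A i k).toNat)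
    (List.nodup_finRange m) using 2
  · rfl
  ext j
  simp only [List.mem_finRange, true_and]
  split_ifs <;> omega

theorem Qop_eqOn {m n : ℕ} {A : Fin m → Fin n → ℤ} {c : Fin m → ℂ}
    {U : Set (Fin n → ℂ)} (hU : IsOpen U) {G : (Fin m → ℕ) → (Fin n → ℂ) → ℂ}
    (hG : ∀ i w, Set.EqOn (linFactor (A i) (c i + (w i : ℕ)) (G w))
      (G (Function.update w i (w i + 1))) U) (k : Fin n) :
    Set.EqOn (Qop A c k (G 0)) (G (fun j => (-A j k).toNat)) U := by
  convert foldr_factorPow_eqOn hU hG (fun i => A i k < 0) (fun i => (A i k).natAbs)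
    (List.nodup_finRange m) using 2
  · rfl
  ext j
  simp only [List.mem_finRange, true_and]
  split_ifs <;> omega

theorem cpow_neg_eq_cpow_neg_add_one_mul {z : ℂ} (hz : z ≠ 0) (t : ℂ) :
    z ^ (-t) = z ^ (-(t + 1)) * z := by
  have h := Complex.cpow_add (-(t + 1)) 1 hz
  rwa [Complex.cpow_one, show -(t + 1) + 1 = -t by ring] at h

theorem xpow_eq_exp {n : ℕ} {x : Fin n → ℂ} (hx : ∀ i, x i ≠ 0) (v : Fin n → ℂ) :
    xpow x v = Complex.exp (∑ i, v i * Complex.log (x i)) := by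
  rw [xpow, Complex.exp_sum]
  exact Finset.prod_congr rfl fun i _ => by rw [Complex.cpow_def_of_ne_zero (hx i), mul_comm]

theorem xpow_add {n : ℕ} {x : Fin n → ℂ} (hx : ∀ i, x i ≠ 0) (u v : Fin n → ℂ) :
    xpow x (fun i => u i + v i) = xpow x u * xpow x v := by
  simp only [xpow, ← Finset.prod_mul_distrib]
  exact Finset.prod_congr rfl fun i _ => Complex.cpow_add _ _ (hx i)

theorem xpow_single {n : ℕ} (x : Fin n → ℂ) (k : Fin n) :
    xpow x (Pi.single k 1) = x k := by
  rw [xpow, Finset.prod_eq_single k]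
  · simp
  · intro j _ hj
    simp [hj]
  · simp

/-- Monomials are eigenfunctions of `⟨b, θ⟩`. -/
theorem exists_hasFDerivAt_xpow {n : ℕ} {x : Fin n → ℂ} (hx : ∀ i, x i ∈ Complex.slitPlane)
    (v : Fin n → ℂ) :
    ∃ f' : (Fin n → ℂ) →L[ℂ] ℂ, HasFDerivAt (fun y => xpow y v) f' x ∧
      ∀ b : Fin n → ℂ, f' (fun k => b k * x k) = (∑ k, b k * v k) * xpow x v := by
  have hlog : HasFDerivAt (fun y : Fin n → ℂ => ∑ i, v i * Complex.log (y i))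
      (∑ i, v i • ((x i)⁻¹ • (ContinuousLinearMap.proj i : (Fin n → ℂ) →L[ℂ] ℂ))) x :=
    HasFDerivAt.fun_sum fun i _ =>
      ((hasFDerivAt_apply (𝕜 := ℂ) i x).clog (hx i)).const_mul (v i)
  have hne : ∀ i, x i ≠ 0 := fun i => Complex.slitPlane_ne_zero (hx i)
  have hev : (fun y => xpow y v) =ᶠ[𝓝 x]
      fun y => Complex.exp (∑ i, v i * Complex.log (y i)) := by
    have h : ∀ᶠ y : Fin n → ℂ in 𝓝 x, ∀ i, y i ≠ 0 :=
      eventually_all.2 fun i => (continuous_apply i).continuousAt.eventually_ne (hne i)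
    exact h.mono fun y hy => xpow_eq_exp hy v
  refine ⟨_, hlog.cexp.congr_of_eventuallyEq hev, fun b => ?_⟩
  rw [xpow_eq_exp hne v, smul_apply, smul_eq_mul, mul_comm]
  congr 1
  rw [sum_apply]
  refine Finset.sum_congr rfl fun k _ => ?_
  have := hne k
  simp only [smul_apply, ContinuousLinearMap.proj_apply, smul_eq_mul]
  field_simp

/-- The polynomial `1 + ∑_j y_j` in the monomials `y_j = x^{-M⁻¹ e_j}`. -/
noncomputable def simplexSum {n : ℕ} (M : Matrix (Fin n) (Fin n) ℤ) (x : Fin n → ℂ) : ℂ :=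
  1 + ∑ j, xpow x (fun i => -(Minv M i j))

/-- The domain of the solution of the simplicial Horn system. -/
def simplexDomain {n : ℕ} (M : Matrix (Fin n) (Fin n) ℤ) : Set (Fin n → ℂ) :=
  {x | (∀ i, x i ∈ Complex.slitPlane) ∧ simplexSum M x ∈ Complex.slitPlane}

/-- The function `x^{-M⁻¹β} (1 + ∑_j x^{-M⁻¹ e_j})^{-t}`. -/
noncomputable def simplexFun {n : ℕ} (M : Matrix (Fin n) (Fin n) ℤ) (β : Fin n → ℂ) (t : ℂ)
    (x : Fin n → ℂ) : ℂ :=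
  xpow x (fun i => -((Minv M).mulVec β i)) * simplexSum M x ^ (-t)

theorem exists_hasFDerivAt_simplexSum {n : ℕ} (M : Matrix (Fin n) (Fin n) ℤ) {x : Fin n → ℂ}
    (hx : ∀ i, x i ∈ Complex.slitPlane) :
    ∃ f' : (Fin n → ℂ) →L[ℂ] ℂ, HasFDerivAt (simplexSum M) f' x ∧
      ∀ b : Fin n → ℂ, f' (fun k => b k * x k)
        = -∑ j, (∑ k, b k * Minv M k j) * xpow x (fun i => -(Minv M i j)) := by
  choose f' hf' hb using fun j => exists_hasFDerivAt_xpow hx (fun i => -(Minv M i j))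
  refine ⟨∑ j, f' j, (HasFDerivAt.fun_sum fun j _ => hf' j).const_add 1, fun b => ?_⟩
  rw [sum_apply, ← Finset.sum_neg_distrib]
  exact Finset.sum_congr rfl fun j _ => by simp [hb]

theorem isOpen_simplexDomain {n : ℕ} (M : Matrix (Fin n) (Fin n) ℤ) :
    IsOpen (simplexDomain M) := by
  refine isOpen_iff_mem_nhds.2 fun x hx => ?_
  obtain ⟨f', hf', -⟩ := exists_hasFDerivAt_simplexSum M hx.1
  have h₁ : ∀ᶠ y : Fin n → ℂ in 𝓝 x, ∀ i, y i ∈ Complex.slitPlane :=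
    eventually_all.2 fun i => (continuous_apply i).continuousAt.eventually_mem
      (Complex.isOpen_slitPlane.mem_nhds (hx.1 i))
  have h₂ : ∀ᶠ y in 𝓝 x, simplexSum M y ∈ Complex.slitPlane :=
    hf'.continuousAt.eventually_mem (Complex.isOpen_slitPlane.mem_nhds hx.2)
  exact h₁.and h₂

theorem fderiv_simplexFun {n : ℕ} (M : Matrix (Fin n) (Fin n) ℤ) (β : Fin n → ℂ) (t : ℂ)
    {x : Fin n → ℂ} (hx : x ∈ simplexDomain M) (b r : Fin n → ℂ)
    (hr : ∀ j, ∑ k, b k * Minv M k j = r j) :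
    DifferentiableAt ℂ (simplexFun M β t) x ∧
    fderiv ℂ (simplexFun M β t) x (fun k => b k * x k)
      = xpow x (fun i => -((Minv M).mulVec β i)) * simplexSum M x ^ (-(t + 1)) *
        (t * (∑ j, r j * xpow x (fun i => -(Minv M i j)))
          - (∑ j, r j * β j) * simplexSum M x) := by
  obtain ⟨S', hS', hSb⟩ := exists_hasFDerivAt_simplexSum M hx.1
  obtain ⟨E', hE', hEb⟩ := exists_hasFDerivAt_xpow hx.1 (fun i => -((Minv M).mulVec β i))
  have hpow : HasFDerivAt (fun y => simplexSum M y ^ (-t))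
      ((-t * simplexSum M x ^ (-t - 1)) • S') x :=
    ((hasStrictDerivAt_id (simplexSum M x)).hasDerivAt.cpow_const (c := -t)
      hx.2).comp_hasFDerivAt x hS' |>.congr_fderiv (by simp)
  have hmul := hE'.mul hpow
  have hS0 : simplexSum M x ≠ 0 := Complex.slitPlane_ne_zero hx.2
  have hsplit := cpow_neg_eq_cpow_neg_add_one_mul hS0 t
  have hβ : ∑ k, b k * -((Minv M).mulVec β k) = -∑ j, r j * β j := by
    simp only [Matrix.mulVec, dotProduct, mul_neg, Finset.sum_neg_distrib, Finset.mul_sum,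
      ← hr, Finset.sum_mul]
    rw [Finset.sum_comm]
    simp only [mul_assoc]
  refine ⟨hmul.differentiableAt, ?_⟩
  have hfd := hmul.fderiv
  change fderiv ℂ (simplexFun M β t) x = _ at hfd
  rw [hfd]
  simp only [add_apply, smul_apply, smul_eq_mul, hSb, hEb,
    hβ, hr, hsplit, show -t - 1 = -(t + 1) by ring]
  ring

/-- The matrix with rows `M_1, …, M_n, -(M_1 + ⋯ + M_n)`. -/
def simplexMatrix {n : ℕ} (M : Matrix (Fin n) (Fin n) ℤ) (i : Fin (n + 1)) (k : Fin n) : ℤ :=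
  if h : (i : ℕ) < n then M ⟨i, h⟩ k else -(∑ l, M l k)

/-- The parameter vector `(α_1, …, α_n, a)`. -/
def simplexParam {n : ℕ} (α : Fin n → ℂ) (a : ℂ) (i : Fin (n + 1)) : ℂ :=
  if h : (i : ℕ) < n then α ⟨i, h⟩ else a

/-- The contiguous functions of the simplicial solution: shifting the parameters by `w` and
normalising by a Pochhammer symbol. -/
noncomputable def simplexFamily {n : ℕ} (M : Matrix (Fin n) (Fin n) ℤ) (α : Fin n → ℂ) (a : ℂ)
    (w : Fin (n + 1) → ℕ) (x : Fin n → ℂ) : ℂ :=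
  (ascPochhammer ℂ (∑ i, w i)).eval ((∑ i, α i) + a) *
    simplexFun M (fun j => α j + (w j.castSucc : ℕ)) ((∑ i, α i) + a + (∑ i, w i : ℕ)) x

section

variable {n : ℕ} {M : Matrix (Fin n) (Fin n) ℤ}

theorem isUnit_det_map (hM : M.det ≠ 0) :
    IsUnit (M.map (Int.cast : ℤ → ℂ)).det := by
  have h : (M.map (Int.cast : ℤ → ℂ)).det = (M.det : ℂ) := ((Int.castRingHom ℂ).map_det M).symm
  rw [h]
  exact (Int.cast_ne_zero.2 hM).isUnit

theorem sum_mul_Minv (hM : M.det ≠ 0) (i j : Fin n) :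
    ∑ k, (M i k : ℂ) * Minv M k j = if i = j then 1 else 0 := by
  have h := congr_fun₂ (Matrix.mul_nonsing_inv _ (isUnit_det_map hM)) i j
  simpa [Matrix.mul_apply, Matrix.one_apply, Minv] using h

theorem sum_Minv_mul (hM : M.det ≠ 0) (i k : Fin n) :
    ∑ j, Minv M i j * (M j k : ℂ) = if i = k then 1 else 0 := by
  have h := congr_fun₂ (Matrix.nonsing_inv_mul _ (isUnit_det_map hM)) i k
  simpa [Matrix.mul_apply, Matrix.one_apply, Minv] using h

theorem linFactor_simplexFamily (hM : M.det ≠ 0) (α : Fin n → ℂ) (a : ℂ) (i : Fin (n + 1))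
    (w : Fin (n + 1) → ℕ) :
    Set.EqOn (linFactor (simplexMatrix M i) (simplexParam α a i + (w i : ℕ))
        (simplexFamily M α a w))
      (simplexFamily M α a (Function.update w i (w i + 1))) (simplexDomain M) := by
  intro x hx
  have hne : ∀ i, x i ≠ 0 := fun i => Complex.slitPlane_ne_zero (hx.1 i)
  have hS0 : simplexSum M x ≠ 0 := Complex.slitPlane_ne_zero hx.2
  have hsum : ∑ j, Function.update w i (w i + 1) j = (∑ j, w j) + 1 := by
    rw [Finset.sum_update_of_mem (Finset.mem_univ i),
      ← Finset.add_sum_erase _ w (Finset.mem_univ i), Finset.sdiff_singleton_eq_erase]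
    ring
  set s : ℂ := (∑ i, α i) + a with hs
  set t : ℂ := s + (∑ i, w i : ℕ) with ht
  set β : Fin n → ℂ := fun j => α j + (w j.castSucc : ℕ) with hβ
  have hsplit := cpow_neg_eq_cpow_neg_add_one_mul hS0 t
  have key : ∀ r : Fin n → ℂ, (∀ j, ∑ k, (simplexMatrix M i k : ℂ) * Minv M k j = r j) →
      linFactor (simplexMatrix M i) (simplexParam α a i + (w i : ℕ)) (simplexFamily M α a w) x
      = (ascPochhammer ℂ (∑ i, w i)).eval s *
        (xpow x (fun i => -((Minv M).mulVec β i)) * simplexSum M x ^ (-(t + 1)) *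
        (t * (∑ j, r j * xpow x (fun i => -(Minv M i j)))
          + (simplexParam α a i + (w i : ℕ) - ∑ j, r j * β j) * simplexSum M x)) := by
    intro r hr
    obtain ⟨hd, hfd⟩ := fderiv_simplexFun M β t hx (fun k => (simplexMatrix M i k : ℂ)) r hr
    have hc : fderiv ℂ (simplexFamily M α a w) x
        = (ascPochhammer ℂ (∑ i, w i)).eval s • fderiv ℂ (simplexFun M β t) x :=
      fderiv_const_mul hd _
    have hv : simplexFamily M α a w x = (ascPochhammer ℂ (∑ i, w i)).eval s *
        (xpow x (fun i => -((Minv M).mulVec β i)) * simplexSum M x ^ (-t)) := rfl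
    rw [linFactor_eq_fderiv, hc, smul_apply, hfd, hv, hsplit, smul_eq_mul]
    ring
  have htarget : simplexFamily M α a (Function.update w i (w i + 1)) x
      = (ascPochhammer ℂ (∑ i, w i)).eval s * t *
        (xpow x (fun l => -((Minv M).mulVec
          (fun j => α j + (Function.update w i (w i + 1) j.castSucc : ℕ)) l)) *
          simplexSum M x ^ (-(t + 1))) := by
    rw [simplexFamily, simplexFun, hsum, ascPochhammer_succ_eval, ht]
    push_cast
    rw [add_assoc s]
  rw [htarget]
  obtain ⟨l, rfl⟩ | rfl := i.eq_castSucc_or_eq_last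
  · rw [key (fun j => if l = j then 1 else 0)
      (fun j => by simpa [simplexMatrix] using sum_mul_Minv hM l j)]
    have hshift : xpow x (fun m => -((Minv M).mulVec (fun j => α j +
        (Function.update w l.castSucc (w l.castSucc + 1) j.castSucc : ℕ)) m))
        = xpow x (fun m => -((Minv M).mulVec β m)) * xpow x (fun m => -(Minv M m l)) := by
      rw [← xpow_add hne]
      congr 1
      ext m
      have hβ' : (fun j => α j +
          ((Function.update w l.castSucc (w l.castSucc + 1) j.castSucc : ℕ) : ℂ))
          = β + Pi.single l 1 := by
        ext j
        by_cases hj : j = l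
        · subst hj
          simp [hβ, add_assoc]
        · simp [hβ, hj]
      rw [hβ', Matrix.mulVec_add, Pi.add_apply, Matrix.mulVec_single_one, Matrix.col_apply]
      ring
    have hpar : simplexParam α a l.castSucc = α l := by simp [simplexParam]
    rw [hshift, hpar]
    simp only [ite_mul, one_mul, zero_mul, Finset.sum_ite_eq, Finset.mem_univ, if_true, hβ]
    ring
  · rw [key (fun _ => -1) (fun j => by
      simp only [simplexMatrix, Fin.val_last, lt_irrefl, dite_false, Int.cast_neg, Int.cast_sum,
        neg_mul, Finset.sum_neg_distrib, Finset.sum_mul]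
      rw [Finset.sum_comm]
      simp [sum_mul_Minv hM])]
    have hpar : simplexParam α a (Fin.last n) = a := by simp [simplexParam]
    have hS : ∑ j, xpow x (fun m => -(Minv M m j)) = simplexSum M x - 1 := by
      simp [simplexSum]
    have ht' : a + (w (Fin.last n) : ℕ) + ∑ j, β j = t := by
      rw [ht, hs, Fin.sum_univ_castSucc w]
      simp only [hβ, Finset.sum_add_distrib]
      push_cast
      ring
    have hw : ∀ j : Fin n, Function.update w (Fin.last n) (w (Fin.last n) + 1) j.castSucc
        = w j.castSucc := fun j => Function.update_of_ne (Fin.castSucc_ne_last j) _ _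
    simp only [hw, neg_mul, one_mul, Finset.sum_neg_distrib, hS, hpar, sub_neg_eq_add, ht', ← hβ]
    ring

theorem mul_xpow_toNat (hM : M.det ≠ 0) (α : Fin n → ℂ) {x : Fin n → ℂ} (hx : ∀ i, x i ≠ 0)
    (k : Fin n) :
    x k * xpow x (fun i => -((Minv M).mulVec (fun j => α j + ((M j k).toNat : ℕ)) i))
      = xpow x (fun i => -((Minv M).mulVec (fun j => α j + ((-M j k).toNat : ℕ)) i)) := by
  rw [← xpow_single x k, ← xpow_add hx]
  congr 1
  ext i
  have h := sum_Minv_mul hM i k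
  have hint : ∀ z : ℤ, (z.toNat : ℂ) = (-z).toNat + z := fun z => by
    have : (z.toNat : ℤ) = (-z).toNat + z := by omega
    exact_mod_cast congrArg (Int.cast : ℤ → ℂ) this
  simp only [Matrix.mulVec, dotProduct, hint (M _ k), ← add_assoc]
  simp only [mul_add, Finset.sum_add_distrib, h, Pi.single_apply]
  ring

theorem hornSol_simplexFun (hM : M.det ≠ 0) (α : Fin n → ℂ) (a : ℂ) :
    HornSol (simplexMatrix M) (simplexParam α a) (simplexDomain M)
      (simplexFun M α ((∑ i, α i) + a)) := by
  intro k x hx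
  have h0 : simplexFun M α ((∑ i, α i) + a) = simplexFamily M α a 0 := by
    ext y
    simp [simplexFamily]
  have hrow : ∀ j : Fin n, simplexMatrix M j.castSucc k = M j k := fun j => by
    simp [simplexMatrix]
  have hsum : ∑ j, (simplexMatrix M j k).toNat = ∑ j, (-simplexMatrix M j k).toNat := by
    have hz : ∑ j, simplexMatrix M j k = 0 := by
      rw [Fin.sum_univ_castSucc]
      simp [simplexMatrix]
    have : ∑ j, (((simplexMatrix M j k).toNat : ℤ) - ((-simplexMatrix M j k).toNat : ℤ)) = 0 := by
      rw [← hz]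
      exact Finset.sum_congr rfl fun j _ => by omega
    rw [Finset.sum_sub_distrib, sub_eq_zero] at this
    exact_mod_cast this
  rw [h0, Pop_eqOn (isOpen_simplexDomain M) (linFactor_simplexFamily hM α a) k hx,
    Qop_eqOn (isOpen_simplexDomain M) (linFactor_simplexFamily hM α a) k hx]
  simp only [simplexFamily, simplexFun, hsum, hrow,
    ← mul_xpow_toNat hM α (fun i => Complex.slitPlane_ne_zero (hx.1 i)) k]
  ring

end

end

/-- Solution formula for simplicial hypergeometric configurations: the function
`x^{-M⁻¹α} (1 + ∑_j x^{-M⁻¹ e_j})^{-|α̃|}` satisfies every equation of the simplicial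
Horn system `Horn(M̃, α̃)` on the indicated open set. -/
theorem stmt5 {n : ℕ} (M : Matrix (Fin n) (Fin n) ℤ) (hM : M.det ≠ 0)
    (α : Fin n → ℂ) (a : ℂ) :
    HornSol
      -- the matrix M̃ with rows M_1, …, M_n, -(M_1 + ⋯ + M_n)
      (fun (i : Fin (n + 1)) (k : Fin n) =>
        if h : (i : ℕ) < n then M ⟨i, h⟩ k else -(∑ l, M l k))
      -- the parameter vector α̃ = (α_1, …, α_n, α_{n+1})
      (fun i : Fin (n + 1) => if h : (i : ℕ) < n then α ⟨i, h⟩ else a)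
      -- the open set U
      {x : Fin n → ℂ | (∀ i, x i ∈ Complex.slitPlane) ∧
        (1 + ∑ j, xpow x (fun i => -(Minv M i j))) ∈ Complex.slitPlane}
      -- the solution f
      (fun x => xpow x (fun i => -((Minv M).mulVec α i)) *
        (1 + ∑ j, xpow x (fun i => -(Minv M i j))) ^ (-((∑ i, α i) + a))) := by
  exact hornSol_simplexFun hM α a
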